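/- For every j with 1 ≤ j ≤ m there exists a chain of degree exactly (1,1,…,1) ∈ ℤ^m from the identity coset to δ^j. Explicitly, the single reflection s_{t_1+t_{m+1}} gives such a chain to δ¹, and the two-step chain with α_1 = 2t_j, α_2 = t_1−t_j (so w = s_{2t_j}∘s_{t_1−t_j}) gives such a chain to δ^j for 2 ≤ j ≤ m. -/

import Mathlib

/-- Roots of `R⁺ \ R_P⁺`: the formal symbols `t_i - t_j`, `t_i + t_j` and `2 t_i`. -/
inductive OddRoot : Type where
  | tminus (i j : ℕ) : OddRoot
  | tplus (i j : ℕ) : OddRoot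
  | double (i : ℕ) : OddRoot
deriving DecidableEq

namespace OddRoot

/-- The conditions for a formal symbol to be a root of `R⁺ \ R_P⁺`. -/
def valid (n m : ℕ) : OddRoot → Prop
  | tminus i j => 1 ≤ i ∧ i ≤ m ∧ i < j ∧ j ≤ n + 1
  | tplus i j => 1 ≤ i ∧ i ≤ m ∧ i < j ∧ j ≤ n + 1
  | double i => 1 ≤ i ∧ i ≤ m

/-- The reflection associated to a root, as a (signed) permutation of the
ground set `{1,…,2n+2}` inside `ℕ`, where `ī = 2n+3-i`. -/
def refl (n : ℕ) : OddRoot → Equiv.Perm ℕ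
  | tminus i j => Equiv.swap i j * Equiv.swap (2*n+3-i) (2*n+3-j)
  | tplus i j => Equiv.swap i (2*n+3-j) * Equiv.swap j (2*n+3-i)
  | double i => Equiv.swap i (2*n+3-i)

/-- The degree vector of a root: `deg α k` is the coefficient of the `k`-th
simple coroot in `α∨`. -/
def deg : OddRoot → ℕ → ℤ
  | tminus i j, k => if i ≤ k ∧ k < j then 1 else 0
  | tplus i j, k => (if i ≤ k then (1:ℤ) else 0) + (if j ≤ k then 1 else 0)
  | double i, k => if i ≤ k then 1 else 0

end OddRoot

/-- The total degree of a chain of roots. -/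
def chainDeg (L : List OddRoot) (k : ℕ) : ℤ := (L.map (fun α => α.deg k)).sum

/-- `IsChainTo n m L lam` : the sequence of roots `L = [α₁,…,α_t]` is a chain from the
identity coset to the tuple `lam`, i.e. each `αᵢ` is in `R⁺ \ R_P⁺` and the composite
`w = s_{α₁} ∘ ⋯ ∘ s_{α_t}` satisfies `w i = lam i` for `1 ≤ i ≤ m`. -/
def IsChainTo (n m : ℕ) (L : List OddRoot) (lam : ℕ → ℕ) : Prop :=
  (∀ α ∈ L, α.valid n m) ∧
  ∀ i ∈ Finset.Icc 1 m, ((L.map (OddRoot.refl n)).prod) i = lam i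

/-- `W^odd`: tuples `(lam 1, …, lam m)` of pairwise distinct elements of `{1,…,2n+1}`
with no two entries summing to `2n+3`. -/
def Wodd (n m : ℕ) (lam : ℕ → ℕ) : Prop :=
  (∀ i ∈ Finset.Icc 1 m, lam i ∈ Finset.Icc 1 (2*n+1)) ∧
  (∀ i ∈ Finset.Icc 1 m, ∀ j ∈ Finset.Icc 1 m, i ≠ j → lam i ≠ lam j) ∧
  (∀ i ∈ Finset.Icc 1 m, ∀ j ∈ Finset.Icc 1 m, lam i + lam j ≠ 2*n+3)

/-- `LamEntry lam k i = Λᵏᵢ`, the `i`-th smallest element of `{lam 1, …, lam k}`. -/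
def LamEntry (lam : ℕ → ℕ) (k i : ℕ) : ℕ :=
  (((Finset.Icc 1 k).image lam).sort (· ≤ ·)).getD (i-1) 0

/-- The Bruhat-type order `λ ⪯ δ`: `Λᵏᵢ ≤ Δᵏᵢ` for all `1 ≤ i ≤ k ≤ m`. -/
def Dominates (m : ℕ) (lam del : ℕ → ℕ) : Prop :=
  ∀ k ∈ Finset.Icc 1 m, ∀ i ∈ Finset.Icc 1 k, LamEntry lam k i ≤ LamEntry del k i

/-- The tuples `δʲ`: `δ¹ = ((m+1)̄ | 2 | 3 | ⋯ | m)` and, for `2 ≤ j ≤ m`,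
`δʲ = (j̄ | 2 | ⋯ | j-1 | 1 | j+1 | ⋯ | m)`. -/
def delta (n m j : ℕ) : ℕ → ℕ := fun i =>
  if j = 1 then (if i = 1 then 2*n+2-m else i)
  else if i = 1 then 2*n+3-j else if i = j then 1 else i

/-- The pattern vector `(0^a 1^b c^(m-a-b))`. -/
def patvec (a b : ℕ) (c : ℤ) : ℕ → ℤ := fun k =>
  if k ≤ a then 0 else if k ≤ a + b then 1 else c

/-- The simple reflections `s_k` (`1 ≤ k ≤ n`, swapping `k ↔ k+1` and `k̄ ↔ (k+1)̄`)
and `s_{n+1}` (swapping `n+1 ↔ (n+1)̄ = n+2`). -/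
def simpleRefl (n k : ℕ) : Equiv.Perm ℕ :=
  if k ≤ n then Equiv.swap k (k+1) * Equiv.swap (2*n+3-k) (2*n+2-k)
  else Equiv.swap (n+1) (n+2)

/-- for every `1 ≤ j ≤ m` there is a chain of degree exactly `(1,…,1)` from the
identity coset to `δʲ`; explicitly, the one-step chain `s_{t_1+t_{m+1}}` works for `δ¹`, and
the two-step chain `α₁ = 2t_j`, `α₂ = t_1 - t_j` works for `δʲ` when `2 ≤ j ≤ m`. -/
theorem chains_to_deltas (n m : ℕ) (hn : 1 ≤ n) (hm : 1 ≤ m) (hmn : m ≤ n) :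
    (∀ j, 1 ≤ j → j ≤ m → ∃ L : List OddRoot,
      IsChainTo n m L (delta n m j) ∧ ∀ k ∈ Finset.Icc 1 m, chainDeg L k = 1) ∧
    (IsChainTo n m [OddRoot.tplus 1 (m+1)] (delta n m 1) ∧
      ∀ k ∈ Finset.Icc 1 m, chainDeg [OddRoot.tplus 1 (m+1)] k = 1) ∧
    (∀ j, 2 ≤ j → j ≤ m →
      IsChainTo n m [OddRoot.double j, OddRoot.tminus 1 j] (delta n m j) ∧
      ∀ k ∈ Finset.Icc 1 m, chainDeg [OddRoot.double j, OddRoot.tminus 1 j] k = 1) := by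
  have h1 : IsChainTo n m [OddRoot.tplus 1 (m+1)] (delta n m 1) ∧
      ∀ k ∈ Finset.Icc 1 m, chainDeg [OddRoot.tplus 1 (m+1)] k = 1 := by
    refine ⟨⟨?_, ?_⟩, ?_⟩
    · intro α hα
      simp only [List.mem_singleton] at hα
      subst hα
      simp only [OddRoot.valid]
      omega
    · intro i hi
      rw [Finset.mem_Icc] at hi
      simp only [List.map_cons, List.map_nil, List.prod_cons, List.prod_nil, mul_one,
        OddRoot.refl, Equiv.Perm.mul_apply, Equiv.swap_apply_def, delta]
      split_ifs <;> omega
    · intro k hk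
      rw [Finset.mem_Icc] at hk
      simp only [chainDeg, List.map_cons, List.map_nil, List.sum_cons, List.sum_nil, OddRoot.deg]
      split_ifs <;> omega
  have h2 : ∀ j, 2 ≤ j → j ≤ m →
      IsChainTo n m [OddRoot.double j, OddRoot.tminus 1 j] (delta n m j) ∧
      ∀ k ∈ Finset.Icc 1 m, chainDeg [OddRoot.double j, OddRoot.tminus 1 j] k = 1 := by
    intro j hj hjm
    refine ⟨⟨?_, ?_⟩, ?_⟩
    · intro α hα
      simp only [List.mem_cons, List.not_mem_nil, or_false] at hα
      rcases hα with rfl | rfl <;> simp only [OddRoot.valid] <;> omega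
    · intro i hi
      rw [Finset.mem_Icc] at hi
      have e : Equiv.swap (2*n+3-1) (2*n+3-j) i = i :=
        Equiv.swap_apply_of_ne_of_ne (by omega) (by omega)
      simp only [List.map_cons, List.map_nil, List.prod_cons, List.prod_nil, mul_one,
        OddRoot.refl, Equiv.Perm.mul_apply, e]
      simp only [Equiv.swap_apply_def, delta]
      split_ifs <;> omega
    · intro k hk
      rw [Finset.mem_Icc] at hk
      simp only [chainDeg, List.map_cons, List.map_nil, List.sum_cons, List.sum_nil, OddRoot.deg]
      split_ifs <;> omega
  refine ⟨?_, h1, h2⟩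
  intro j hj hjm
  rcases Nat.lt_or_ge j 2 with h | h
  · obtain rfl : j = 1 := by omega
    exact ⟨_, h1⟩
  · exact ⟨_, h2 j h hjm⟩
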